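/- arXiv:1312.7142 — 2 statements merged into one kernel-verified Lean document; each statement's English description precedes it below -/
import Mathlib

section
/- (Seshadri–Wesołowski.) Let X and Y be two independent random variables, each positive almost surely and neither almost surely constant, with E(Y) < ∞. Set U = 1/(X + Y) and V = 1/X − 1/(X + Y). Assume X follows the GIG(−p, a, b) distribution for some p, a, b > 0. If V is integrable and E(V | U) = 2p/b almost surely, then Y follows the Γ(p, a/2) distribution. -/
open MeasureTheory ProbabilityTheory Real Set Filter

/-- Unnormalized density of the GIG(p, a, b) distribution on (0, ∞). -/
noncomputable def gigpdf (p a b : ℝ) (x : ℝ) : ℝ :=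
  if 0 < x then x ^ (p - 1) * Real.exp (-(a * x + b / x) / 2) else 0

/-- Unnormalized density of the Gamma distribution with shape p and rate c on (0, ∞). -/
noncomputable def gampdf (p c : ℝ) (x : ℝ) : ℝ :=
  if 0 < x then x ^ (p - 1) * Real.exp (-(c * x)) else 0

/-- The law of `X` under `μ` has a Lebesgue density proportional to `g`. -/
def HasLawProp {Ω : Type*} [MeasurableSpace Ω] (μ : Measure Ω) (X : Ω → ℝ) (g : ℝ → ℝ) : Prop :=
  ∃ k : ℝ, 0 < k ∧ Measure.map X μ = volume.withDensity (fun x => ENNReal.ofReal (k * g x))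

/-- `X` follows the GIG(p, a, b) distribution under `μ`. -/
def HasLawGIG {Ω : Type*} [MeasurableSpace Ω] (μ : Measure Ω) (X : Ω → ℝ) (p a b : ℝ) : Prop :=
  HasLawProp μ X (gigpdf p a b)

/-- `X` follows the Gamma(p, c) distribution under `μ`. -/
def HasLawGamma {Ω : Type*} [MeasurableSpace Ω] (μ : Measure Ω) (X : Ω → ℝ) (p c : ℝ) : Prop :=
  HasLawProp μ X (gampdf p c)

/-- `U = 1/(X + Y)`. -/
noncomputable def uMY {Ω : Type*} (X Y : Ω → ℝ) (ω : Ω) : ℝ := 1 / (X ω + Y ω)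

/-- `V = 1/X - 1/(X + Y)`. -/
noncomputable def vMY {Ω : Type*} (X Y : Ω → ℝ) (ω : Ω) : ℝ := 1 / X ω - 1 / (X ω + Y ω)

/-- Two measures on `ℝ` whose moment generating functions are finite and agree near some point
are equal. -/
lemma ext_of_mgf_id_eventuallyEq {μ ν : Measure ℝ} {t : ℝ}
    (hμ : t ∈ interior (integrableExpSet id μ)) (hν : t ∈ interior (integrableExpSet id ν))
    (h : mgf id μ =ᶠ[nhds t] mgf id ν) : μ = ν := by
  have key : EqOn (complexMGF id μ) (complexMGF id ν)
      {z | z.re ∈ interior (integrableExpSet id μ) ∩ interior (integrableExpSet id ν)} := by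
    refine AnalyticOnNhd.eqOn_of_preconnected_of_frequently_eq
      (analyticOnNhd_complexMGF.mono fun z hz ↦ hz.1)
      (analyticOnNhd_complexMGF.mono fun z hz ↦ hz.2)
      ((convex_integrableExpSet.interior.inter
        convex_integrableExpSet.interior).linear_preimage Complex.reLm).isPreconnected
      (z₀ := (t : ℂ)) ⟨by simpa using hμ, by simpa using hν⟩ ?_
    have hreal : ∃ᶠ x : ℝ in nhdsWithin t {t}ᶜ, complexMGF id μ x = complexMGF id ν x := by
      refine Eventually.frequently ?_
      filter_upwards [nhdsWithin_le_nhds h] with x hx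
      rw [complexMGF_ofReal, complexMGF_ofReal, hx]
    have htend : Tendsto (fun x : ℝ ↦ (x : ℂ)) (nhdsWithin t {t}ᶜ)
        (nhdsWithin (t : ℂ) {(t : ℂ)}ᶜ) := by
      refine tendsto_nhdsWithin_iff.2 ⟨?_, ?_⟩
      · exact (Complex.continuous_ofReal.tendsto t).mono_left nhdsWithin_le_nhds
      · filter_upwards [self_mem_nhdsWithin] with x hx
        simpa using hx
    exact htend.frequently hreal
  have hmeas : Measurable fun x : ℝ ↦ ENNReal.ofReal (exp (t * x)) := by fun_prop
  have hfin {κ : Measure ℝ} (hκ : t ∈ interior (integrableExpSet id κ)) :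
      IsFiniteMeasure (κ.withDensity fun x ↦ ENNReal.ofReal (exp (t * x))) :=
    isFiniteMeasure_withDensity_ofReal
      (integrable_of_mem_integrableExpSet (interior_subset hκ)).2
  have hchar (κ : Measure ℝ) (u : ℝ) :
      charFun (κ.withDensity fun x ↦ ENNReal.ofReal (exp (t * x))) u
        = complexMGF id κ (t + u * Complex.I) := by
    rw [charFun_apply_real, integral_withDensity_eq_integral_toReal_smul hmeas (by simp),
      complexMGF]
    refine integral_congr_ae (ae_of_all _ fun x ↦ ?_)
    simp only [ENNReal.toReal_ofReal (exp_pos _).le, Complex.real_smul, Complex.ofReal_exp,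
      ← Complex.exp_add, id]
    congr 1
    push_cast
    ring
  have htilt : μ.withDensity (fun x ↦ ENNReal.ofReal (exp (t * x)))
      = ν.withDensity fun x ↦ ENNReal.ofReal (exp (t * x)) := by
    have := hfin hμ
    have := hfin hν
    refine Measure.ext_of_charFun (funext fun u ↦ ?_)
    rw [hchar, hchar]
    exact key (by simpa using ⟨hμ, hν⟩)
  have hinv (κ : Measure ℝ) : (κ.withDensity fun x ↦ ENNReal.ofReal (exp (t * x))).withDensity
      (fun x ↦ ENNReal.ofReal (exp (t * x)))⁻¹ = κ :=
    withDensity_inv_same hmeas (ae_of_all _ fun x ↦ by simp [exp_pos]) (ae_of_all _ fun x ↦ by simp)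
  rw [← hinv μ, htilt, hinv ν]

/-- The exponential moments of a nonnegative random variable are finite on the negative half-line. -/
lemma Iio_zero_subset_interior_integrableExpSet {Ω : Type*} [MeasurableSpace Ω] {μ : Measure Ω}
    [IsFiniteMeasure μ] {X : Ω → ℝ} (hXm : AEMeasurable X μ) (hX : ∀ᵐ ω ∂μ, 0 ≤ X ω) :
    Iio 0 ⊆ interior (integrableExpSet X μ) := by
  refine interior_maximal (fun t ht ↦ ?_) isOpen_Iio
  refine Integrable.of_bound (by fun_prop) 1 ?_
  filter_upwards [hX] with ω hω
  rw [norm_eq_abs, abs_of_pos (exp_pos _), exp_le_one_iff]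
  exact mul_nonpos_of_nonpos_of_nonneg (mem_Iio.1 ht).le hω

lemma mul_exp_neg_mul_le {t x : ℝ} (ht : 0 < t) : x * exp (-(t * x)) ≤ 1 / t := by
  have h1 : t * x ≤ exp (t * x) := by linarith [add_one_le_exp (t * x)]
  rw [exp_neg, ← div_eq_mul_inv, div_le_div_iff₀ (exp_pos _) ht]
  linarith

lemma integrable_mul_exp_neg_mul {Ω : Type*} [MeasurableSpace Ω] {μ : Measure Ω}
    [IsFiniteMeasure μ] {X : Ω → ℝ} (hXm : AEMeasurable X μ) (hX : ∀ᵐ ω ∂μ, 0 ≤ X ω)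
    {t : ℝ} (ht : 0 < t) : Integrable (fun ω ↦ X ω * exp (-(t * X ω))) μ := by
  refine Integrable.of_bound (by fun_prop) (1 / t) ?_
  filter_upwards [hX] with ω hω
  rw [norm_eq_abs, abs_of_nonneg (by positivity)]
  exact mul_exp_neg_mul_le ht

lemma integrable_exp_neg_mul {Ω : Type*} [MeasurableSpace Ω] {μ : Measure Ω}
    [IsFiniteMeasure μ] {X : Ω → ℝ} (hXm : AEMeasurable X μ) (hX : ∀ᵐ ω ∂μ, 0 ≤ X ω)
    {t : ℝ} (ht : 0 < t) : Integrable (fun ω ↦ exp (-(t * X ω))) μ := by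
  have h := integrable_of_mem_integrableExpSet (interior_subset
    (Iio_zero_subset_interior_integrableExpSet hXm hX (mem_Iio.2 (neg_neg_of_pos ht))))
  simpa only [neg_mul] using h

lemma measurable_gigpdf (p a b : ℝ) : Measurable (gigpdf p a b) :=
  Measurable.ite measurableSet_Ioi (by fun_prop) measurable_const

lemma measurable_gampdf (p c : ℝ) : Measurable (gampdf p c) :=
  Measurable.ite measurableSet_Ioi (by fun_prop) measurable_const

lemma gigpdf_nonneg (p a b x : ℝ) : 0 ≤ gigpdf p a b x := by
  unfold gigpdf
  split_ifs <;> positivity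

lemma gampdf_nonneg (p c x : ℝ) : 0 ≤ gampdf p c x := by
  unfold gampdf
  split_ifs <;> positivity

/-- Integration by parts for a GIG-distributed variable tilted by `x ↦ exp (-t x)`. -/
lemma HasLawGIG.integral_stein {Ω : Type*} [MeasurableSpace Ω] {μ : Measure Ω} {X : Ω → ℝ}
    (hXm : Measurable X) {p a b t : ℝ} (hp : 0 < p) (ha : 0 < a) (hb : 0 < b) (ht : 0 < t)
    (hX : HasLawGIG μ X (-p) a b)
    (hint : Integrable
      (fun ω ↦ (-p - (a / 2 + t) * X ω + b / 2 / X ω) * exp (-(t * X ω))) μ) :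
    ∫ ω, (-p - (a / 2 + t) * X ω + b / 2 / X ω) * exp (-(t * X ω)) ∂μ = 0 := by
  obtain ⟨k, hk, hlaw⟩ := hX
  set h : ℝ → ℝ := fun x ↦ (-p - (a / 2 + t) * x + b / 2 / x) * exp (-(t * x)) with hh
  set F : ℝ → ℝ := fun x ↦ x ^ (-p) * exp (-(a * x + b / x) / 2 - t * x) with hF
  have hhm : Measurable h := by fun_prop
  have hden : Measurable fun x ↦ ENNReal.ofReal (k * gigpdf (-p) a b x) :=
    ((measurable_gigpdf _ _ _).const_mul k).ennreal_ofReal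
  have htoReal (x : ℝ) : (ENNReal.ofReal (k * gigpdf (-p) a b x)).toReal • h x
      = (Ioi 0).indicator (fun x ↦ k * (x ^ (-p - 1) * exp (-(a * x + b / x) / 2) * h x)) x := by
    rw [ENNReal.toReal_ofReal (mul_nonneg hk.le (gigpdf_nonneg _ _ _ _)), smul_eq_mul]
    by_cases hx : 0 < x
    · rw [indicator_of_mem (mem_Ioi.2 hx), gigpdf, if_pos hx]
      ring
    · rw [indicator_of_notMem (by simpa using hx), gigpdf, if_neg hx]
      simp
  have hintF : IntegrableOn (fun x ↦ k * (x ^ (-p - 1) * exp (-(a * x + b / x) / 2) * h x))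
      (Ioi 0) := by
    have h1 : Integrable h (Measure.map X μ) :=
      (integrable_map_measure hhm.aestronglyMeasurable hXm.aemeasurable).2 hint
    rw [hlaw, integrable_withDensity_iff_integrable_smul' hden (by simp)] at h1
    simp only [htoReal] at h1
    exact (integrable_indicator_iff measurableSet_Ioi).1 h1
  have hderiv : ∀ x ∈ Ioi (0 : ℝ), HasDerivAt (fun x ↦ k * F x)
      (k * (x ^ (-p - 1) * exp (-(a * x + b / x) / 2) * h x)) x := by
    intro x hx
    have hx0 : x ≠ 0 := (mem_Ioi.1 hx).ne'
    have hE : HasDerivAt (fun x ↦ -(a * x + b / x) / 2 - t * x)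
        (-(a + -b / x ^ 2) / 2 - t) x := by
      have h2 : HasDerivAt (fun x ↦ b / x) (-b / x ^ 2) x := by
        simpa [div_eq_mul_inv, neg_mul] using (hasDerivAt_inv hx0).const_mul b
      have h3 := hasDerivAt_const_mul a (x := x)
      have h4 := hasDerivAt_const_mul t (x := x)
      exact ((h3.add h2).neg.div_const 2).sub h4
    refine (((Real.hasDerivAt_rpow_const (p := -p) (Or.inl hx0)).mul hE.exp).const_mul k).congr_deriv
      ?_
    have h5 : x ^ (-p) = x ^ (-p - 1) * x := by
      rw [← rpow_add_one hx0]
      ring_nf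
    have h6 : exp (-(a * x + b / x) / 2 - t * x)
        = exp (-(a * x + b / x) / 2) * exp (-(t * x)) := by
      rw [← exp_add]
      ring_nf
    simp only [hh, h5, h6]
    field_simp
    ring
  have hzero : F 0 = 0 := by simp [hF, zero_rpow (neg_ne_zero.2 hp.ne')]
  have hbound : ∀ x ∈ Ioi (0 : ℝ), 0 ≤ F x := fun x hx ↦
    mul_nonneg (rpow_nonneg (mem_Ioi.1 hx).le _) (exp_pos _).le
  have hcont : ContinuousWithinAt (fun x ↦ k * F x) (Ici 0) 0 := by
    refine ContinuousWithinAt.const_smul (c := k) ?_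
    rw [← continuousWithinAt_Ioi_iff_Ici, ContinuousWithinAt, hzero]
    have hlim := (tendsto_rpow_mul_exp_neg_mul_atTop_nhds_zero p (b / 2) (by positivity)).comp
      tendsto_inv_nhdsGT_zero
    refine tendsto_of_tendsto_of_tendsto_of_le_of_le' tendsto_const_nhds hlim ?_ ?_
    · filter_upwards [self_mem_nhdsWithin] with x hx using hbound x hx
    · filter_upwards [self_mem_nhdsWithin] with x hx
      have hx' : 0 < x := hx
      simp only [hF, Function.comp, inv_rpow hx'.le, ← rpow_neg hx'.le]
      refine mul_le_mul_of_nonneg_left (exp_le_exp.2 ?_) (rpow_nonneg hx'.le _)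
      have h7 : -(b / 2) * x⁻¹ = -(b / x) / 2 := by
        field_simp
      have h8 : 0 < a * x := by positivity
      have h9 : 0 < t * x := by positivity
      rw [h7]
      linarith
  have htop : Tendsto (fun x ↦ k * F x) atTop (nhds (k * 0)) := by
    refine Tendsto.const_mul k ?_
    refine tendsto_of_tendsto_of_tendsto_of_le_of_le' tendsto_const_nhds
      (tendsto_rpow_neg_atTop hp) ?_ ?_
    · filter_upwards [Ioi_mem_atTop 0] with x hx using hbound x hx
    · filter_upwards [Ioi_mem_atTop 0] with x hx
      have hx' : 0 < x := hx
      refine mul_le_of_le_one_right (rpow_nonneg hx'.le _) (exp_le_one_iff.2 ?_)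
      have h8 : 0 < a * x := by positivity
      have h9 : 0 < t * x := by positivity
      have h10 : 0 < b / x := by positivity
      linarith
  calc ∫ ω, h (X ω) ∂μ = ∫ x, h x ∂(Measure.map X μ) :=
        (integral_map hXm.aemeasurable hhm.aestronglyMeasurable).symm
    _ = ∫ x in Ioi 0, k * (x ^ (-p - 1) * exp (-(a * x + b / x) / 2) * h x) := by
        rw [hlaw, integral_withDensity_eq_integral_toReal_smul hden (by simp)]
        simp only [htoReal]
        rw [integral_indicator measurableSet_Ioi]
    _ = 0 := by
        rw [integral_Ioi_of_hasDerivAt_of_tendsto hcont hderiv hintF htop, hzero]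
        simp

/-- Testing the regression condition `E(V | U) = c` against `S exp (-t S)`, where `S = X + Y`,
and using independence. -/
lemma integral_laplace_of_condExp_vMY {Ω : Type*} [MeasurableSpace Ω] {μ : Measure Ω}
    [IsProbabilityMeasure μ] {X Y : Ω → ℝ} (hXm : Measurable X) (hYm : Measurable Y)
    (hXpos : ∀ᵐ ω ∂μ, 0 < X ω) (hYpos : ∀ᵐ ω ∂μ, 0 < Y ω) (hindep : IndepFun X Y μ)
    (hVint : Integrable (vMY X Y) μ) {c : ℝ}
    (hc : μ[vMY X Y | MeasurableSpace.comap (uMY X Y) inferInstance] =ᵐ[μ] fun _ => c)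
    {t : ℝ} (ht : 0 < t) :
    Integrable (fun ω ↦ (X ω)⁻¹ * exp (-(t * X ω))) μ ∧
      (∫ ω, (X ω)⁻¹ * exp (-(t * X ω)) ∂μ) * ∫ ω, Y ω * exp (-(t * Y ω)) ∂μ
      = c * ((∫ ω, X ω * exp (-(t * X ω)) ∂μ) * ∫ ω, exp (-(t * Y ω)) ∂μ
        + (∫ ω, exp (-(t * X ω)) ∂μ) * ∫ ω, Y ω * exp (-(t * Y ω)) ∂μ) := by
  set f : Ω → ℝ := fun ω ↦ (X ω + Y ω) * exp (-(t * (X ω + Y ω))) with hf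
  have hX0 : ∀ᵐ ω ∂μ, 0 ≤ X ω := hXpos.mono fun _ h ↦ h.le
  have hY0 : ∀ᵐ ω ∂μ, 0 ≤ Y ω := hYpos.mono fun _ h ↦ h.le
  have hUm : Measurable (uMY X Y) := measurable_const.div (hXm.add hYm)
  have hm : MeasurableSpace.comap (uMY X Y) inferInstance ≤ (inferInstance : MeasurableSpace Ω) :=
    hUm.comap_le
  have hfm : StronglyMeasurable[MeasurableSpace.comap (uMY X Y) inferInstance] f := by
    have h1 : f = (fun u : ℝ ↦ u⁻¹ * exp (-(t * u⁻¹))) ∘ uMY X Y := by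
      funext ω
      simp [hf, uMY]
    rw [h1]
    have h2 : Measurable fun u : ℝ ↦ u⁻¹ * exp (-(t * u⁻¹)) := by fun_prop
    exact (h2.comp (comap_measurable _)).stronglyMeasurable
  have hfb : ∀ᵐ ω ∂μ, ‖f ω‖ ≤ 1 / t := by
    filter_upwards [hXpos, hYpos] with ω hx hy
    rw [norm_eq_abs, abs_of_nonneg (by positivity)]
    exact mul_exp_neg_mul_le ht
  have hfV : Integrable (f * vMY X Y) μ := hVint.bdd_mul (hfm.mono hm).aestronglyMeasurable hfb
  have hcond : ∫ ω, f ω * vMY X Y ω ∂μ = c * ∫ ω, f ω ∂μ := by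
    have h1 := condExp_stronglyMeasurable_mul_of_bound hm hfm hVint _ hfb
    calc ∫ ω, f ω * vMY X Y ω ∂μ
        = ∫ ω, (μ[f * vMY X Y | MeasurableSpace.comap (uMY X Y) inferInstance]) ω ∂μ :=
          (integral_condExp hm).symm
      _ = ∫ ω, c * f ω ∂μ := by
          refine integral_congr_ae ?_
          filter_upwards [h1, hc] with ω h2 h3
          rw [h2, Pi.mul_apply, h3, mul_comm]
      _ = c * ∫ ω, f ω ∂μ := integral_const_mul _ _
  have hsplit : (fun ω ↦ f ω * vMY X Y ω) =ᵐ[μ]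
      fun ω ↦ ((X ω)⁻¹ * exp (-(t * X ω))) * (Y ω * exp (-(t * Y ω))) := by
    filter_upwards [hXpos, hYpos] with ω hx hy
    have h1 : exp (-(t * (X ω + Y ω))) = exp (-(t * X ω)) * exp (-(t * Y ω)) := by
      rw [← exp_add]
      ring_nf
    have h2 : X ω + Y ω ≠ 0 := by positivity
    simp only [hf, vMY, h1]
    field_simp
    ring
  have hfsplit : f = fun ω ↦ X ω * exp (-(t * X ω)) * exp (-(t * Y ω))
      + exp (-(t * X ω)) * (Y ω * exp (-(t * Y ω))) := by
    funext ω
    have h1 : exp (-(t * (X ω + Y ω))) = exp (-(t * X ω)) * exp (-(t * Y ω)) := by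
      rw [← exp_add]
      ring_nf
    simp only [hf, h1]
    ring
  have hind {g h : ℝ → ℝ} (hg : Measurable g) (hh : Measurable h) :
      IndepFun (fun ω ↦ g (X ω)) (fun ω ↦ h (Y ω)) μ := hindep.comp hg hh
  have hind₁ := hind (g := fun x ↦ x⁻¹ * exp (-(t * x))) (h := fun y ↦ y * exp (-(t * y)))
    (by fun_prop) (by fun_prop)
  have hind₂ := hind (g := fun x ↦ x * exp (-(t * x))) (h := fun y ↦ exp (-(t * y)))
    (by fun_prop) (by fun_prop)
  have hind₃ := hind (g := fun x ↦ exp (-(t * x))) (h := fun y ↦ y * exp (-(t * y)))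
    (by fun_prop) (by fun_prop)
  refine ⟨?_, ?_⟩
  · refine hind₁.integrable_left_of_integrable_op (· * ·) 1 one_ne_zero
      (fun x y ↦ by simp [enorm_mul]) (hfV.congr hsplit) (by fun_prop) (by fun_prop) fun h0 ↦ ?_
    obtain ⟨ω, h1, h2⟩ := (hYpos.and h0).exists
    have h3 : 0 < Y ω * exp (-(t * Y ω)) := by positivity
    exact h3.ne' h2
  · rw [← hind₁.integral_fun_mul_eq_mul_integral (by fun_prop) (by fun_prop),
      ← integral_congr_ae hsplit, hcond, hfsplit, integral_add,
      hind₂.integral_fun_mul_eq_mul_integral (by fun_prop) (by fun_prop),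
      hind₃.integral_fun_mul_eq_mul_integral (by fun_prop) (by fun_prop)]
    · exact hind₂.integrable_mul (integrable_mul_exp_neg_mul hXm.aemeasurable hX0 ht)
        (integrable_exp_neg_mul hYm.aemeasurable hY0 ht)
    · exact hind₃.integrable_mul (integrable_exp_neg_mul hXm.aemeasurable hX0 ht)
        (integrable_mul_exp_neg_mul hYm.aemeasurable hY0 ht)

/-- The moment generating function of a measure with density proportional to `gampdf p c`. -/
lemma mgf_id_withDensity_gampdf {k p c s : ℝ} (hk : 0 ≤ k) (hp : 0 < p) (hs : s < c) :
    mgf id (volume.withDensity fun x ↦ ENNReal.ofReal (k * gampdf p c x)) s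
      = k * ((c - s) ^ (-p) * Gamma p) := by
  have hcs : 0 < c - s := sub_pos.2 hs
  have hden : Measurable fun x ↦ ENNReal.ofReal (k * gampdf p c x) :=
    ((measurable_gampdf _ _).const_mul k).ennreal_ofReal
  rw [mgf, integral_withDensity_eq_integral_toReal_smul hden (by simp)]
  have h1 (x : ℝ) : (ENNReal.ofReal (k * gampdf p c x)).toReal • exp (s * id x)
      = (Ioi 0).indicator (fun x ↦ k * (x ^ (p - 1) * exp (-((c - s) * x)))) x := by
    rw [ENNReal.toReal_ofReal (mul_nonneg hk (gampdf_nonneg _ _ _)), smul_eq_mul]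
    by_cases hx : 0 < x
    · have h2 : exp (-((c - s) * x)) = exp (-(c * x)) * exp (s * x) := by
        rw [← exp_add]
        ring_nf
      rw [indicator_of_mem (mem_Ioi.2 hx), gampdf, if_pos hx, h2, id]
      ring
    · rw [indicator_of_notMem (by simpa using hx), gampdf, if_neg hx]
      simp
  simp only [h1]
  rw [integral_indicator measurableSet_Ioi, integral_const_mul,
    Real.integral_rpow_mul_exp_neg_mul_Ioi hp hcs, one_div, inv_rpow hcs.le, ← rpow_neg hcs.le]

/-- A positive random variable whose Laplace transform satisfies the differential equation of the
Gamma distribution is Gamma distributed. -/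
lemma hasLawGamma_of_integral_laplace {Ω : Type*} [MeasurableSpace Ω] {μ : Measure Ω}
    [IsProbabilityMeasure μ] {Y : Ω → ℝ} (hYm : Measurable Y) (hYpos : ∀ᵐ ω ∂μ, 0 < Y ω)
    {p c : ℝ} (hp : 0 < p) (hc : 0 < c)
    (h : ∀ t, 0 < t → (c + t) * ∫ ω, Y ω * exp (-(t * Y ω)) ∂μ = p * ∫ ω, exp (-(t * Y ω)) ∂μ) :
    HasLawGamma μ Y p c := by
  have hY0 : ∀ᵐ ω ∂μ, 0 ≤ Y ω := hYpos.mono fun _ h ↦ h.le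
  have hIio := Iio_zero_subset_interior_integrableExpSet hYm.aemeasurable hY0
  have hderiv : ∀ s ∈ Iio (0 : ℝ), HasDerivAt (fun s ↦ mgf Y μ s * (c - s) ^ p) 0 s := by
    intro s hs
    have hs' : s < 0 := hs
    have hcs : 0 < c - s := by linarith
    have h1 : HasDerivAt (fun s : ℝ ↦ (c - s) ^ p) (-1 * p * (c - s) ^ (p - 1)) s :=
      ((hasDerivAt_id s).const_sub c).rpow_const (Or.inl hcs.ne')
    refine ((hasDerivAt_mgf (hIio hs)).mul h1).congr_deriv ?_
    have h2 := h (-s) (by linarith)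
    simp only [neg_mul, neg_neg, ← sub_eq_add_neg] at h2
    have h3 : (c - s) ^ p = (c - s) ^ (p - 1) * (c - s) := by
      rw [← rpow_add_one hcs.ne']
      ring_nf
    rw [h3, mgf]
    linear_combination (c - s) ^ (p - 1) * h2
  obtain ⟨C, hC⟩ := isOpen_Iio.exists_is_const_of_deriv_eq_zero (convex_Iio 0).isPreconnected
    (fun s hs ↦ (hderiv s hs).differentiableAt.differentiableWithinAt)
    (fun s hs ↦ (hderiv s hs).deriv)
  have hmgf : ∀ s < 0, mgf Y μ s = C * (c - s) ^ (-p) := by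
    intro s hs
    have hcs : 0 < c - s := by linarith
    rw [← hC s hs, rpow_neg hcs.le, mul_assoc, mul_inv_cancel₀ (rpow_pos_of_pos hcs p).ne',
      mul_one]
  have hCpos : 0 < C := by
    rw [← hC (-1) (by simp)]
    have h1 : (-1 : ℝ) ∈ integrableExpSet Y μ := interior_subset (hIio (by simp))
    exact mul_pos (mgf_pos h1) (rpow_pos_of_pos (by linarith) _)
  have hG : 0 < Gamma p := Gamma_pos_of_pos hp
  have hk : 0 < C / Gamma p := by positivity
  refine ⟨C / Gamma p, hk, ?_⟩
  have heq : ∀ s < 0, mgf id (Measure.map Y μ) s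
      = mgf id (volume.withDensity fun x ↦ ENNReal.ofReal (C / Gamma p * gampdf p c x)) s := by
    intro s hs
    rw [mgf_id_withDensity_gampdf hk.le hp (by linarith), mgf_id_map hYm.aemeasurable, hmgf s hs]
    field_simp
  have hset : Iio 0 ⊆ integrableExpSet id
      (volume.withDensity fun x ↦ ENNReal.ofReal (C / Gamma p * gampdf p c x)) := by
    intro s hs
    have hcs : 0 < c - s := by linarith [mem_Iio.1 hs]
    refine Integrable.of_integral_ne_zero (ne_of_gt ?_)
    have h1 := mgf_id_withDensity_gampdf hk.le hp (show s < c by linarith)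
    rw [mgf] at h1
    rw [h1]
    positivity
  have hset' : Iio 0 ⊆ interior (integrableExpSet id (Measure.map Y μ)) := by
    have : IsProbabilityMeasure (Measure.map Y μ) :=
      Measure.isProbabilityMeasure_map hYm.aemeasurable
    exact Iio_zero_subset_interior_integrableExpSet aemeasurable_id
      ((ae_map_iff hYm.aemeasurable measurableSet_Ici).2 hY0)
  have hneg : (-1 : ℝ) ∈ Iio (0 : ℝ) := by simp
  refine ext_of_mgf_id_eventuallyEq (t := -1) (hset' hneg)
    (interior_maximal hset isOpen_Iio hneg) ?_
  filter_upwards [isOpen_Iio.mem_nhds hneg] with s hs using heq s hs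

/-- Seshadri–Wesołowski: if `X ~ GIG(-p, a, b)` and `E(V | U) = 2p/b` a.s., then
`Y ~ Γ(p, a/2)`. -/
theorem seshadri_wesolowski_gamma_from_gig
    {Ω : Type*} [MeasurableSpace Ω] (μ : Measure Ω) [IsProbabilityMeasure μ]
    (X Y : Ω → ℝ) (hXm : Measurable X) (hYm : Measurable Y)
    (hXpos : ∀ᵐ ω ∂μ, 0 < X ω) (hYpos : ∀ᵐ ω ∂μ, 0 < Y ω)
    (hXnd : ¬ ∃ k : ℝ, ∀ᵐ ω ∂μ, X ω = k) (hYnd : ¬ ∃ k : ℝ, ∀ᵐ ω ∂μ, Y ω = k)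
    (hindep : IndepFun X Y μ)
    (hYint : Integrable Y μ)
    (p a b : ℝ) (hp : 0 < p) (ha : 0 < a) (hb : 0 < b)
    (hX : HasLawGIG μ X (-p) a b)
    (hVint : Integrable (vMY X Y) μ)
    (hc : μ[vMY X Y | MeasurableSpace.comap (uMY X Y) inferInstance] =ᵐ[μ]
      fun _ => 2 * p / b) :
    HasLawGamma μ Y p (a / 2) := by
  refine hasLawGamma_of_integral_laplace hYm hYpos hp (by positivity) fun t ht ↦ ?_
  obtain ⟨hψ, hlap⟩ :=
    integral_laplace_of_condExp_vMY hXm hYm hXpos hYpos hindep hVint hc ht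
  have hX0 : ∀ᵐ ω ∂μ, 0 ≤ X ω := hXpos.mono fun _ h ↦ h.le
  have hφ := integrable_exp_neg_mul hXm.aemeasurable hX0 ht
  have hξ := integrable_mul_exp_neg_mul hXm.aemeasurable hX0 ht
  have hexpand (ω : Ω) : (-p - (a / 2 + t) * X ω + b / 2 / X ω) * exp (-(t * X ω))
      = -p * exp (-(t * X ω)) - (a / 2 + t) * (X ω * exp (-(t * X ω)))
        + b / 2 * ((X ω)⁻¹ * exp (-(t * X ω))) := by
    ring
  have hstein : -p * (∫ ω, exp (-(t * X ω)) ∂μ) - (a / 2 + t) * (∫ ω, X ω * exp (-(t * X ω)) ∂μ)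
      + b / 2 * (∫ ω, (X ω)⁻¹ * exp (-(t * X ω)) ∂μ) = 0 := by
    have h1 : Integrable (fun ω ↦ -p * exp (-(t * X ω))
        - (a / 2 + t) * (X ω * exp (-(t * X ω)))) μ := (hφ.const_mul _).sub (hξ.const_mul _)
    have h2 := hX.integral_stein hXm hp ha hb ht (by
      simp only [hexpand]
      exact h1.add (hψ.const_mul _))
    simp only [hexpand] at h2
    rwa [integral_add h1 (hψ.const_mul _), integral_sub (hφ.const_mul _) (hξ.const_mul _),
      integral_const_mul, integral_const_mul, integral_const_mul] at h2
  have hξpos : 0 < ∫ ω, X ω * exp (-(t * X ω)) ∂μ := by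
    refine (integral_pos_iff_support_of_nonneg_ae ?_ hξ).2 ?_
    · filter_upwards [hX0] with ω hω
      exact mul_nonneg hω (exp_pos _).le
    · have h1 : ∀ᵐ ω ∂μ, ω ∈ Function.support fun ω ↦ X ω * exp (-(t * X ω)) := by
        filter_upwards [hXpos] with ω hω
        exact (mul_pos hω (exp_pos _)).ne'
      have h2 := (measure_congr (eventuallyEq_univ.2 h1)).trans measure_univ
      exact one_pos.trans_eq h2.symm
  refine mul_left_cancel₀ hξpos.ne' ?_
  have hpb : b / 2 * (2 * p / b) = p := by
    field_simp
  generalize (∫ ω, X ω * exp (-(t * X ω)) ∂μ) = ξ at *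
  generalize (∫ ω, exp (-(t * X ω)) ∂μ) = φ at *
  generalize (∫ ω, (X ω)⁻¹ * exp (-(t * X ω)) ∂μ) = ψ at *
  generalize (∫ ω, Y ω * exp (-(t * Y ω)) ∂μ) = η at *
  generalize (∫ ω, exp (-(t * Y ω)) ∂μ) = M at *
  linear_combination (b / 2) * hlap - η * hstein + (ξ * M + φ * η) * hpb
end

section
/- (MLE characterization of GIG laws.) Fix an integer n ≥ 3, p ∈ ℝ and θ > 0. Let f : (0, ∞) → (0, ∞) be a differentiable probability density on (0, ∞). For x₁, …, x_n > 0 set x̄ = (1/n)·Σ_{i=1}^n x_i, x̄₋₁ = (1/n)·Σ_{i=1}^n 1/x_i, and η̂(x₁, …, x_n) = (√(p² + θ²·x̄·x̄₋₁) − p)/(θ·x̄₋₁). Then the following are equivalent: (i) for every x₁, …, x_n > 0, the scale likelihood η ↦ Π_{i=1}^n (1/η)·f(x_i/η) attains its maximum over (0, ∞) at η = η̂(x₁, …, x_n); (ii) there exist d > 0 and C > 0 such that f(x) = C·x^(p·d − 1)·exp(−θ·d·(x + 1/x)/2) for all x > 0, i.e. f is the density of the GIG(p·d, θ·d, θ·d)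 distribution. -/
open MeasureTheory ProbabilityTheory Real Set Filter

/-- The sample mean `x̄ = (1/n) Σ xᵢ`. -/
noncomputable def sampleMean (n : ℕ) (x : Fin n → ℝ) : ℝ := (1 / n : ℝ) * ∑ i, x i

/-- The sample harmonic term `x̄₋₁ = (1/n) Σ 1/xᵢ`. -/
noncomputable def sampleMeanInv (n : ℕ) (x : Fin n → ℝ) : ℝ := (1 / n : ℝ) * ∑ i, (x i)⁻¹

/-- The candidate MLE `η̂ = (√(p² + θ² x̄ x̄₋₁) - p)/(θ x̄₋₁)`. -/
noncomputable def gigEtaHat (p θ : ℝ) (n : ℕ) (x : Fin n → ℝ) : ℝ :=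
  (Real.sqrt (p ^ 2 + θ ^ 2 * sampleMean n x * sampleMeanInv n x) - p)
    / (θ * sampleMeanInv n x)

/-- The GIG scale likelihood `η ↦ ∏ i, η^(-p) · xᵢ^(p-1) · exp(-θ(xᵢ/η + η/xᵢ)/2)`
(with the η-free normalizing constant removed). -/
noncomputable def gigScaleLik (p θ : ℝ) (n : ℕ) (x : Fin n → ℝ) (η : ℝ) : ℝ :=
  ∏ i, η ^ (-p) * x i ^ (p - 1) * Real.exp (-θ * (x i / η + η / x i) / 2)

/-- The function of the data whose vanishing sum characterizes `η̂ = 1`. -/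
noncomputable def gigScore (p θ x : ℝ) : ℝ := θ / 2 * (x - x⁻¹) - p

/-- The inverse of `gigScore p θ : (0, ∞) → ℝ`. -/
noncomputable def gigScoreInv (p θ u : ℝ) : ℝ := (u + p) / θ + √(((u + p) / θ) ^ 2 + 1)

lemma gigScoreInv_pos (p θ u : ℝ) : 0 < gigScoreInv p θ u := by
  unfold gigScoreInv
  set w := (u + p) / θ
  have h : |w| < √(w ^ 2 + 1) := by
    rw [← Real.sqrt_sq_eq_abs]
    exact Real.sqrt_lt_sqrt (sq_nonneg w) (by linarith)
  linarith [neg_abs_le w]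

lemma gigScore_gigScoreInv {p θ : ℝ} (hθ : 0 < θ) (u : ℝ) :
    gigScore p θ (gigScoreInv p θ u) = u := by
  have hpos := gigScoreInv_pos p θ u
  have key : gigScoreInv p θ u - (gigScoreInv p θ u)⁻¹ = 2 * ((u + p) / θ) := by
    field_simp
    unfold gigScoreInv at *
    set w := (u + p) / θ with hw
    have hs : √(w ^ 2 + 1) ^ 2 = w ^ 2 + 1 := Real.sq_sqrt (by positivity)
    have hu : u + p = w * θ := by rw [hw]; field_simp
    rw [hu]
    linear_combination θ * hs
  rw [gigScore, key]
  field_simp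
  ring

lemma gigScoreInv_gigScore {p θ x : ℝ} (hθ : 0 < θ) (hx : 0 < x) :
    gigScoreInv p θ (gigScore p θ x) = x := by
  have hw : (gigScore p θ x + p) / θ = (x - x⁻¹) / 2 := by
    unfold gigScore
    field_simp
    ring
  have hs : ((x - x⁻¹) / 2) ^ 2 + 1 = ((x + x⁻¹) / 2) ^ 2 := by
    field_simp
    ring
  rw [gigScoreInv, hw, hs, Real.sqrt_sq (by positivity)]
  ring

lemma measurable_gigScoreInv (p θ : ℝ) : Measurable (gigScoreInv p θ) := by
  unfold gigScoreInv
  fun_prop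

lemma sampleMean_pos {n : ℕ} (hn : 0 < n) {x : Fin n → ℝ} (hx : ∀ i, 0 < x i) :
    0 < sampleMean n x := by
  have : NeZero n := ⟨hn.ne'⟩
  have : 0 < ∑ i, x i := Finset.sum_pos (fun i _ => hx i) Finset.univ_nonempty
  have : (0 : ℝ) < n := by exact_mod_cast hn
  unfold sampleMean
  positivity

lemma sampleMeanInv_eq_sampleMean (n : ℕ) (x : Fin n → ℝ) :
    sampleMeanInv n x = sampleMean n fun i => (x i)⁻¹ := rfl

lemma sampleMeanInv_pos {n : ℕ} (hn : 0 < n) {x : Fin n → ℝ} (hx : ∀ i, 0 < x i) :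
    0 < sampleMeanInv n x :=
  sampleMeanInv_eq_sampleMean n x ▸ sampleMean_pos hn fun i => inv_pos.2 (hx i)

/-- `η̂` is positive and is a root of the quadratic likelihood equation. -/
lemma gigEtaHat_spec {n : ℕ} (hn : 0 < n) {p θ : ℝ} (hθ : 0 < θ) {x : Fin n → ℝ}
    (hx : ∀ i, 0 < x i) :
    0 < gigEtaHat p θ n x ∧
      θ * sampleMeanInv n x * gigEtaHat p θ n x ^ 2 + 2 * p * gigEtaHat p θ n x
        = θ * sampleMean n x := by
  have hA := sampleMean_pos hn hx
  have hB := sampleMeanInv_pos hn hx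
  unfold gigEtaHat
  set A := sampleMean n x
  set B := sampleMeanInv n x
  have hs : √(p ^ 2 + θ ^ 2 * A * B) ^ 2 = p ^ 2 + θ ^ 2 * A * B :=
    Real.sq_sqrt (by positivity)
  constructor
  · have : |p| < √(p ^ 2 + θ ^ 2 * A * B) := by
      rw [← Real.sqrt_sq_eq_abs]
      exact Real.sqrt_lt_sqrt (sq_nonneg p) (by nlinarith [show 0 < θ ^ 2 * A * B by positivity])
    exact div_pos (by linarith [le_abs_self p]) (by positivity)
  · generalize √(p ^ 2 + θ ^ 2 * A * B) = s at hs ⊢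
    field_simp
    linear_combination hs

lemma gigEtaHat_eq_one {n : ℕ} (hn : 0 < n) {p θ : ℝ} (hθ : 0 < θ) {x : Fin n → ℝ}
    (hx : ∀ i, 0 < x i) (hsum : ∑ i, gigScore p θ (x i) = 0) :
    gigEtaHat p θ n x = 1 := by
  have hA := sampleMean_pos hn hx
  have hB := sampleMeanInv_pos hn hx
  have hn' : (0 : ℝ) < n := by exact_mod_cast hn
  obtain ⟨hpos, hroot⟩ := gigEtaHat_spec hn (p := p) hθ hx
  have hlin : θ * sampleMeanInv n x + 2 * p = θ * sampleMean n x := by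
    simp only [gigScore, Finset.sum_sub_distrib, ← Finset.mul_sum, Finset.sum_const,
      Finset.card_univ, Fintype.card_fin, nsmul_eq_mul] at hsum
    unfold sampleMean sampleMeanInv
    generalize ∑ i, (x i)⁻¹ = S at hsum ⊢
    field_simp
    linear_combination -2 * hsum
  set e := gigEtaHat p θ n x
  have hfac : (e - 1) * (θ * sampleMeanInv n x * e + θ * sampleMean n x) = 0 := by
    linear_combination hroot - e * hlin
  rcases mul_eq_zero.1 hfac with h | h
  · linarith
  · have : 0 < θ * sampleMeanInv n x * e + θ * sampleMean n x := by positivity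
    linarith

/-- If the scale likelihood of a sample is maximized at `1`, the likelihood equation holds. -/
lemma sum_score_eq_zero_of_isMaxOn {n : ℕ} {f : ℝ → ℝ} (hfpos : ∀ x, 0 < x → 0 < f x)
    (hfdiff : DifferentiableOn ℝ f (Ioi 0)) {x : Fin n → ℝ} (hx : ∀ i, 0 < x i)
    (hmax : ∀ η : ℝ, 0 < η → ∏ i, (1 / η) * f (x i / η) ≤ ∏ i, f (x i)) :
    ∑ i, (1 + x i * deriv (fun y => Real.log (f y)) (x i)) = 0 := by
  set F : ℝ → ℝ := fun η => ∑ i, (-Real.log η + Real.log (f (x i / η)))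
  have hF : ∀ η : ℝ, 0 < η → F η = Real.log (∏ i, (1 / η) * f (x i / η)) := fun η hη => by
    have hf : ∀ i, f (x i / η) ≠ 0 := fun i => (hfpos _ (div_pos (hx i) hη)).ne'
    rw [Real.log_prod fun i _ => mul_ne_zero (by positivity) (hf i)]
    refine Finset.sum_congr rfl fun i _ => ?_
    rw [Real.log_mul (by positivity) (hf i), one_div, Real.log_inv]
  have hloc : IsLocalMax F 1 := by
    filter_upwards [Ioi_mem_nhds (zero_lt_one (α := ℝ))] with η hη
    rw [hF η hη, hF 1 one_pos]
    refine Real.log_le_log (Finset.prod_pos fun i _ => ?_) (by simpa using hmax η hη)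
    exact mul_pos (one_div_pos.2 hη) (hfpos _ (div_pos (hx i) hη))
  have hder : HasDerivAt F (∑ i, (-(1 + x i * deriv (fun y => Real.log (f y)) (x i)))) 1 := by
    refine HasDerivAt.fun_sum fun i _ => ?_
    have hlog : HasDerivAt (fun y => Real.log (f y))
        (deriv (fun y => Real.log (f y)) (x i)) (x i / 1) := by
      rw [div_one]
      exact ((hfdiff.differentiableAt (Ioi_mem_nhds (hx i))).log
        (hfpos _ (hx i)).ne').hasDerivAt
    have hdiv : HasDerivAt (fun η : ℝ => x i / η) (-x i) 1 := by
      simpa [div_eq_mul_inv] using (hasDerivAt_inv (one_ne_zero (α := ℝ))).const_mul (x i)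
    have h := (Real.hasDerivAt_log (one_ne_zero (α := ℝ))).neg.add (hlog.comp 1 hdiv)
    convert h using 1
    · rfl
    · ring
  have h0 := hloc.hasDerivAt_eq_zero hder
  rw [Finset.sum_neg_distrib] at h0
  linarith

/-- A measurable function whose sums vanish over zero-sum vectors of length at least three
is linear. -/
lemma eq_mul_of_sum_eq_zero {n : ℕ} (hn : 3 ≤ n) {G : ℝ → ℝ} (hG : Measurable G)
    (h : ∀ u : Fin n → ℝ, ∑ i, u i = 0 → ∑ i, G (u i) = 0) (u : ℝ) : G u = u * G 1 := by
  obtain ⟨m, rfl⟩ : ∃ m, n = m + 3 := ⟨n - 3, by omega⟩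
  have hzero : G 0 = 0 := by
    have := h (fun _ => 0) (by simp)
    simp only [Finset.sum_const, Finset.card_univ, Fintype.card_fin, nsmul_eq_mul] at this
    exact (mul_eq_zero.1 this).resolve_left (by positivity)
  have htriple : ∀ a b c : ℝ, a + b + c = 0 → G a + G b + G c = 0 := fun a b c habc => by
    have := h (Fin.cons a (Fin.cons b (Fin.cons c fun _ => 0)))
      (by simp [Fin.sum_univ_succ]; linarith)
    simp [Fin.sum_univ_succ, hzero] at this
    linarith
  let φ : ℝ →+ ℝ := AddMonoidHom.mk' G fun a b => by
    have h₁ := htriple a b (-(a + b)) (by ring)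
    have h₂ := htriple (a + b) (-(a + b)) 0 (by ring)
    linarith
  have := map_real_smul φ (MeasureTheory.Measure.AddMonoidHom.continuous_of_measurable φ hG) u 1
  simpa [φ] using this

/-- A positive function on `(0, ∞)` whose logarithmic score is linear in `gigScore` has the
GIG form. -/
lemma exists_eq_gig_of_score {p θ d : ℝ} {f : ℝ → ℝ} (hfpos : ∀ x, 0 < x → 0 < f x)
    (hfdiff : DifferentiableOn ℝ f (Ioi 0))
    (hscore : ∀ x, 0 < x →
      1 + x * deriv (fun y => Real.log (f y)) x = -(d * gigScore p θ x)) :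
    ∃ C : ℝ, 0 < C ∧ ∀ x : ℝ, 0 < x →
      f x = C * x ^ (p * d - 1) * Real.exp (-(θ * d) * (x + 1 / x) / 2) := by
  set q : ℝ → ℝ := fun x => (p * d - 1) * Real.log x + -(θ * d) * (x + 1 / x) / 2
  have hq : ∀ x, 0 < x →
      HasDerivAt q ((p * d - 1) * x⁻¹ + -(θ * d) * (1 + -(x ^ 2)⁻¹) / 2) x := fun x hx => by
    have h1 : HasDerivAt (fun x : ℝ => 1 / x) (-(x ^ 2)⁻¹) x := by
      simpa using hasDerivAt_inv hx.ne'
    exact ((Real.hasDerivAt_log hx.ne').const_mul _).add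
      ((((hasDerivAt_id x).add h1).const_mul _).div_const 2)
  have hl : DifferentiableOn ℝ (fun y => Real.log (f y)) (Ioi 0) :=
    hfdiff.log fun x hx => (hfpos x hx).ne'
  obtain ⟨a, ha⟩ := isOpen_Ioi.exists_eq_add_of_deriv_eq isPreconnected_Ioi hl
    (fun x hx => (hq x hx).differentiableAt.differentiableWithinAt) fun x hx => by
      have hx : 0 < x := hx
      rw [(hq x hx).deriv]
      have := hscore x hx
      unfold gigScore at this
      field_simp at this ⊢
      linear_combination this
  refine ⟨Real.exp a, Real.exp_pos a, fun x hx => ?_⟩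
  have hax : Real.log (f x) = q x + a := ha hx
  rw [← Real.exp_log (hfpos x hx), hax, Real.rpow_def_of_pos hx, ← Real.exp_add, ← Real.exp_add]
  congr 1
  simp only [q]
  ring

/-- A function of GIG form with integral one has a positive exponent parameter. -/
lemma pos_of_integral_gig_eq_one {p θ d C : ℝ} (hθ : 0 < θ) (hC : 0 < C) {f : ℝ → ℝ}
    (hf : ∀ x : ℝ, 0 < x →
      f x = C * x ^ (p * d - 1) * Real.exp (-(θ * d) * (x + 1 / x) / 2))
    (hfdens : ∫ x in Ioi (0 : ℝ), f x = 1) : 0 < d := by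
  by_contra! hd
  have hint : IntegrableOn f (Ioi 0) := by
    by_contra hnot
    rw [integral_undef hnot] at hfdens
    exact zero_ne_one hfdens
  refine not_integrableOn_Ioi_rpow (p * d - 1) ?_
  refine Integrable.mono' (hint.const_mul C⁻¹) (by fun_prop) ?_
  filter_upwards [ae_restrict_mem measurableSet_Ioi] with x hx
  have hx : 0 < x := hx
  rw [Real.norm_of_nonneg (by positivity), hf x hx, mul_assoc C, inv_mul_cancel_left₀ hC.ne']
  refine le_mul_of_one_le_right (by positivity) (Real.one_le_exp ?_)
  have : 0 ≤ -(θ * d) := by nlinarith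
  positivity

/-- The value `η̂` minimizes the negative log-likelihood of the GIG scale family. -/
lemma gig_negLogLik_le {p θ A B e η : ℝ} (hθ : 0 < θ) (hA : 0 < A) (hB : 0 < B)
    (he : 0 < e) (hη : 0 < η) (hroot : θ * B * e ^ 2 + 2 * p * e = θ * A) :
    p * Real.log e + θ / 2 * (A / e + e * B) ≤ p * Real.log η + θ / 2 * (A / η + η * B) := by
  obtain ⟨r, hr, rfl⟩ : ∃ r, 0 < r ∧ η = r * e := ⟨η / e, by positivity, by field_simp⟩
  rw [Real.log_mul hr.ne' he.ne']
  have h₁ : 0 ≤ θ * A / (2 * e) * (r⁻¹ - 1 + Real.log r) := by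
    have := Real.log_le_sub_one_of_pos (inv_pos.2 hr)
    rw [Real.log_inv] at this
    exact mul_nonneg (by positivity) (by linarith)
  have h₂ : 0 ≤ θ * B * e / 2 * (r - 1 - Real.log r) := by
    have := Real.log_le_sub_one_of_pos hr
    exact mul_nonneg (by positivity) (by linarith)
  have hp : p = θ * A / (2 * e) - θ * B * e / 2 := by
    field_simp
    linear_combination hroot
  have : p * (Real.log r + Real.log e) + θ / 2 * (A / (r * e) + r * e * B)
      - (p * Real.log e + θ / 2 * (A / e + e * B))
      = θ * A / (2 * e) * (r⁻¹ - 1 + Real.log r) + θ * B * e / 2 * (r - 1 - Real.log r) := by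
    have h : p * Real.log r = (θ * A / (2 * e) - θ * B * e / 2) * Real.log r := by rw [← hp]
    have h' : A / (r * e) = A / e * r⁻¹ := by field_simp
    rw [h']
    have h'' : θ * A / (2 * e) = θ / 2 * (A / e) := by field_simp
    rw [h''] at h ⊢
    linear_combination h
  linarith

/-- The scale likelihood of a density of GIG form. -/
lemma prod_gig_scale_eq {n : ℕ} (hn : 0 < n) {p θ d C η : ℝ} (hη : 0 < η) {f : ℝ → ℝ}
    (hf : ∀ x : ℝ, 0 < x →
      f x = C * x ^ (p * d - 1) * Real.exp (-(θ * d) * (x + 1 / x) / 2))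
    {x : Fin n → ℝ} (hx : ∀ i, 0 < x i) :
    ∏ i, (1 / η) * f (x i / η) = (∏ i, C * x i ^ (p * d - 1)) *
      Real.exp (-(d * n * (p * Real.log η +
        θ / 2 * (sampleMean n x / η + η * sampleMeanInv n x)))) := by
  have hterm : ∀ i, (1 / η) * f (x i / η) = (C * x i ^ (p * d - 1)) *
      Real.exp (-d * (p * Real.log η + θ / 2 * (x i / η + η * (x i)⁻¹))) := fun i => by
    have hxi := hx i
    have hη' : (1 / η) = Real.exp (-Real.log η) := by
      rw [Real.exp_neg, Real.exp_log hη, one_div]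
    rw [hf _ (div_pos hxi hη), hη', Real.rpow_def_of_pos (div_pos hxi hη),
      Real.rpow_def_of_pos hxi, Real.log_div hxi.ne' hη.ne']
    have hinv : 1 / (x i / η) = η * (x i)⁻¹ := by field_simp
    rw [hinv, mul_assoc C, mul_assoc C, ← Real.exp_add, ← Real.exp_add, mul_left_comm,
      ← Real.exp_add]
    congr 2
    ring
  rw [Finset.prod_congr rfl fun i _ => hterm i, Finset.prod_mul_distrib, ← Real.exp_sum]
  congr 2
  have hn' : (n : ℝ) ≠ 0 := by exact_mod_cast hn.ne'
  rw [← Finset.mul_sum, Finset.sum_add_distrib, ← Finset.mul_sum, ← Finset.mul_sum,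
    Finset.sum_add_distrib, ← Finset.sum_div, ← Finset.mul_sum]
  simp only [sampleMean, sampleMeanInv, Finset.sum_const, Finset.card_univ, Fintype.card_fin,
    nsmul_eq_mul]
  generalize ∑ i, (x i)⁻¹ = S
  field_simp

/-- MLE characterization of GIG laws: for `n ≥ 3`, `η̂ = (√(p² + θ² x̄ x̄₋₁) - p)/(θ x̄₋₁)`
is the MLE of the scale parameter in the scale family generated by `f` for all samples of
size `n` iff `f` is (for some `d > 0`) the density of `GIG(pd, θd, θd)`, i.e.
`f(x) = C x^{pd-1} e^{-θd(x + 1/x)/2}`. -/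
theorem gig_mle_characterization
    (n : ℕ) (hn : 3 ≤ n) (p θ : ℝ) (hθ : 0 < θ)
    (f : ℝ → ℝ) (hfpos : ∀ x, 0 < x → 0 < f x)
    (hfdiff : DifferentiableOn ℝ f (Set.Ioi 0))
    (hfdens : ∫ x in Set.Ioi (0 : ℝ), f x = 1) :
    (∀ x : Fin n → ℝ, (∀ i, 0 < x i) →
        ∀ η : ℝ, 0 < η →
          (∏ i, (1 / η) * f (x i / η)) ≤
            ∏ i, (1 / gigEtaHat p θ n x) * f (x i / gigEtaHat p θ n x)) ↔
      ∃ d C : ℝ, 0 < d ∧ 0 < C ∧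
        ∀ x : ℝ, 0 < x →
          f x = C * x ^ (p * d - 1) * Real.exp (-(θ * d) * (x + 1 / x) / 2) := by
  have hn0 : 0 < n := by omega
  constructor
  · intro hmle
    set G : ℝ → ℝ := fun u => 1 + gigScoreInv p θ u *
      deriv (fun y => Real.log (f y)) (gigScoreInv p θ u)
    have hGmeas : Measurable G := by
      have hk := measurable_gigScoreInv p θ
      exact (hk.mul ((measurable_deriv _).comp hk)).const_add 1
    have hGsum : ∀ u : Fin n → ℝ, ∑ i, u i = 0 → ∑ i, G (u i) = 0 := fun u hu => by
      have hx : ∀ i, 0 < gigScoreInv p θ (u i) := fun i => gigScoreInv_pos p θ (u i)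
      have heta : gigEtaHat p θ n (fun i => gigScoreInv p θ (u i)) = 1 :=
        gigEtaHat_eq_one hn0 hθ hx (by simpa only [gigScore_gigScoreInv hθ] using hu)
      refine sum_score_eq_zero_of_isMaxOn hfpos hfdiff hx fun η hη => ?_
      simpa [heta] using hmle _ hx η hη
    obtain ⟨C, hC, hf⟩ := exists_eq_gig_of_score (p := p) (θ := θ) (d := -G 1) hfpos hfdiff
      fun x hx => by
        have h := eq_mul_of_sum_eq_zero hn hGmeas hGsum (gigScore p θ x)
        have hGx : G (gigScore p θ x) = 1 + x * deriv (fun y => Real.log (f y)) x := by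
          simp only [G, gigScoreInv_gigScore hθ hx]
        rw [← hGx, h]
        ring
    exact ⟨-G 1, C, pos_of_integral_gig_eq_one hθ hC hf hfdens, hC, hf⟩
  · rintro ⟨d, C, hd, hC, hf⟩ x hx η hη
    obtain ⟨he, hroot⟩ := gigEtaHat_spec hn0 (p := p) hθ hx
    rw [prod_gig_scale_eq hn0 hη hf hx, prod_gig_scale_eq hn0 he hf hx]
    have hle := gig_negLogLik_le hθ (sampleMean_pos hn0 hx) (sampleMeanInv_pos hn0 hx)
      he hη hroot
    have hconst : 0 ≤ ∏ i, C * x i ^ (p * d - 1) :=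
      Finset.prod_nonneg fun i _ => mul_nonneg hC.le (Real.rpow_nonneg (hx i).le _)
    gcongr
end
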